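/- Let S be an inverse semigroup and N a normal inverse subsemigroup of S. For s ∈ S, there exists an idempotent e ∈ E(S) with s ≤_N e if and only if s ∈ N. -/

import Mathlib

/-- An inverse semigroup: a semigroup in which every element `s` has a
(unique) inverse `s⁻¹` with `s * s⁻¹ * s = s` and `s⁻¹ * s * s⁻¹ = s⁻¹`. -/
class InverseSemigroup (S : Type*) extends Semigroup S, Inv S where
  mul_inv_mul : ∀ s : S, s * s⁻¹ * s = s
  inv_mul_inv : ∀ s : S, s⁻¹ * s * s⁻¹ = s⁻¹
  inv_unique : ∀ s t : S, s * t * s = s → t * s * t = t → t = s⁻¹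

/-- The natural partial order on an inverse semigroup:
`s ≤ t` iff `s = e * t` for some idempotent `e`. -/
def NatLe {S : Type*} [InverseSemigroup S] (s t : S) : Prop :=
  ∃ e : S, IsIdempotentElem e ∧ s = e * t

/-- A normal inverse subsemigroup: a full inverse subsemigroup that is
closed under conjugation. -/
structure IsNormalInverseSubsemigroup {S : Type*} [InverseSemigroup S] (N : Set S) : Prop where
  mul_mem : ∀ {a b : S}, a ∈ N → b ∈ N → a * b ∈ N
  inv_mem : ∀ {a : S}, a ∈ N → a⁻¹ ∈ N
  full : ∀ {e : S}, IsIdempotentElem e → e ∈ N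
  conj_mem : ∀ (s : S) {n : S}, n ∈ N → s⁻¹ * n * s ∈ N

/-- The preorder `≤_N` associated to a normal inverse subsemigroup `N`:
`s ≤_N t` iff there are `a, b ∈ N` with `a⁻¹ * a = s * s⁻¹`,
`s⁻¹ * s = b * b⁻¹` (so `a · s · b` is a trace product) and `a * s * b ≤ t`. -/
def LeN {S : Type*} [InverseSemigroup S] (N : Set S) (s t : S) : Prop :=
  ∃ a ∈ N, ∃ b ∈ N, a⁻¹ * a = s * s⁻¹ ∧ s⁻¹ * s = b * b⁻¹ ∧ NatLe (a * s * b) t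

/-- The equivalence `≃_N` obtained by symmetrizing `≤_N`. -/
def SimeqN {S : Type*} [InverseSemigroup S] (N : Set S) (s t : S) : Prop :=
  LeN N s t ∧ LeN N t s

namespace InverseSemigroup

variable {S : Type*} [InverseSemigroup S]

theorem inv_inv_eq (s : S) : s⁻¹⁻¹ = s :=
  (InverseSemigroup.inv_unique s⁻¹ s (inv_mul_inv s) (mul_inv_mul s)).symm

theorem isIdempotentElem_inv_mul (s : S) : IsIdempotentElem (s⁻¹ * s) := by
  rw [IsIdempotentElem, ← mul_assoc, inv_mul_inv]

theorem _root_.IsIdempotentElem.inv_eq_self {e : S} (he : IsIdempotentElem e) : e⁻¹ = e :=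
  (InverseSemigroup.inv_unique e e (by rw [he.eq, he.eq]) (by rw [he.eq, he.eq])).symm

end InverseSemigroup

open InverseSemigroup in
/-- `s ≤_N e` for some idempotent `e` if and only if `s ∈ N`. -/
theorem leN_idempotent_iff_mem {S : Type*} [InverseSemigroup S] {N : Set S}
    (hN : IsNormalInverseSubsemigroup N) (s : S) :
    (∃ e : S, IsIdempotentElem e ∧ LeN N s e) ↔ s ∈ N := by
  constructor
  · rintro ⟨e, he, a, ha, b, hb, hab, hsb, f, hf, hfe⟩
    have key : a⁻¹ * (a * s * b) * b⁻¹ = s := by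
      calc a⁻¹ * (a * s * b) * b⁻¹ = (a⁻¹ * a) * s * (b * b⁻¹) := by simp only [mul_assoc]
        _ = s := by rw [hab, ← hsb, mul_inv_mul, ← mul_assoc, mul_inv_mul]
    rw [← key, hfe]
    exact hN.mul_mem (hN.mul_mem (hN.inv_mem ha) (hN.mul_mem (hN.full hf) (hN.full he)))
      (hN.inv_mem hb)
  · intro hs
    have hi := isIdempotentElem_inv_mul s
    refine ⟨s⁻¹ * s, hi, s⁻¹, hN.inv_mem hs, s⁻¹ * s, hN.full hi, ?_, ?_, s⁻¹ * s, hi, rfl⟩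
    · rw [inv_inv_eq]
    · rw [hi.inv_eq_self, hi.eq]
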